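/- Assume in addition that φ(t) > 0 for every t > 0, and let u be a nontrivial nonnegative entire bounded solution of Δ^{α/2}u = ρ·φ(u) on ℝ^N; set M = sup_{ℝ^N} u > 0 and A = {x ∈ ℝ^N : 2·u(x) ≤ M}. Then: (i) the function s = 2·(M − u) is continuous, nonnegative, satisfies Δ^{α/2}s ≤ 0 in the distributional sense on ℝ^N, s ≥ M on A, and s(x₁) < M for some x₁ ∈ ℝ^N; (ii) for every x ∈ ℝ^N, ∫_{ℝ^N∖A} ρ(y)·|x−y|^{-(N−α)} dy ≤ M/(C_{N,α}·φ(M/2)) < ∞, where C_{N,α} = 2^{-α}·π^{-N/2}·Γ((N−α)/2)/Γ(α/2). -/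

import Mathlib

open MeasureTheory Real Filter Topology

noncomputable section

/-- The constant `c_{N,-α} = 2^α · π^{-N/2} · Γ((N+α)/2) / |Γ(-α/2)|`. -/
def fracLapCoeff (N : ℕ) (α : ℝ) : ℝ :=
  2 ^ α * Real.pi ^ (-(N : ℝ) / 2) * Real.Gamma (((N : ℝ) + α) / 2) / |Real.Gamma (-α / 2)|

/-- The fractional Laplacian `Δ^{α/2}θ` of a test function `θ`. -/
def fracLap (N : ℕ) (α : ℝ) (θ : EuclideanSpace ℝ (Fin N) → ℝ)
    (x : EuclideanSpace ℝ (Fin N)) : ℝ :=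
  (fracLapCoeff N α / 2) *
    ∫ z : EuclideanSpace ℝ (Fin N), (θ (x + z) + θ (x - z) - 2 * θ x) / ‖z‖ ^ ((N : ℝ) + α)

/-- A nonnegative entire bounded (distributional) solution of `Δ^{α/2}u = ρ·φ(u)` on `ℝ^N`. -/
def IsEntireSol (N : ℕ) (α : ℝ) (ρ : EuclideanSpace ℝ (Fin N) → ℝ) (φ : ℝ → ℝ)
    (u : EuclideanSpace ℝ (Fin N) → ℝ) : Prop :=
  Continuous u ∧ (∃ M, ∀ x, u x ≤ M) ∧ (∀ x, 0 ≤ u x) ∧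
  LocallyIntegrable (fun x => ρ x * φ (u x)) ∧
  ∀ θ : EuclideanSpace ℝ (Fin N) → ℝ, ContDiff ℝ (⊤ : ℕ∞) θ → HasCompactSupport θ →
    (∫ x, u x * fracLap N α θ x) = ∫ x, ρ x * φ (u x) * θ x

/-- The Riesz constant `C_{N,α} = 2^{-α} · π^{-N/2} · Γ((N-α)/2) / Γ(α/2)`. -/
def rieszCoeff (N : ℕ) (α : ℝ) : ℝ :=
  2 ^ (-α) * Real.pi ^ (-(N : ℝ) / 2) * Real.Gamma (((N : ℝ) - α) / 2) / Real.Gamma (α / 2)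

/-- The substitution `t ↦ 1/t` in Euler's integral. -/
lemma integral_rpow_mul_exp_neg_div_Ioi {a q : ℝ} (ha : 0 < a) (hq : 0 < q) :
    ∫ t in Set.Ioi (0 : ℝ), t ^ (-a - 1) * rexp (-(q / t)) = (1 / q) ^ a * Gamma a := by
  rw [← integral_rpow_mul_exp_neg_mul_Ioi ha hq,
    ← integral_comp_rpow_Ioi (fun s => s ^ (a - 1) * rexp (-(q * s))) (show (-1 : ℝ) ≠ 0 by norm_num)]
  refine setIntegral_congr_fun measurableSet_Ioi fun t ht => ?_
  have ht' : (0 : ℝ) < t := ht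
  simp only [abs_neg, abs_one, one_mul, smul_eq_mul]
  rw [← mul_assoc, ← rpow_mul ht'.le, ← rpow_add ht', rpow_neg_one, div_eq_mul_inv]
  congr 2
  ring

lemma integrableOn_rpow_mul_exp_neg_div_Ioi {a q : ℝ} (ha : 0 < a) (hq : 0 < q) :
    IntegrableOn (fun t : ℝ => t ^ (-a - 1) * rexp (-(q / t))) (Set.Ioi 0) := by
  refine .of_integral_ne_zero ?_
  rw [integral_rpow_mul_exp_neg_div_Ioi ha hq]
  have := Gamma_pos_of_pos ha
  positivity

lemma one_sub_exp_neg_le {x : ℝ} : 1 - rexp (-x) ≤ x := by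
  linarith [add_one_le_exp (-x)]

lemma integrableOn_rpow_mul_one_sub_exp {b l : ℝ} (hb : 0 < b) (hb1 : b < 1) (hl : 0 ≤ l) :
    IntegrableOn (fun t : ℝ => t ^ (-b - 1) * (1 - rexp (-(t * l)))) (Set.Ioi 0) := by
  have hm : Measurable fun t : ℝ => t ^ (-b - 1) * (1 - rexp (-(t * l))) := by fun_prop
  rw [← Set.Ioc_union_Ioi_eq_Ioi zero_le_one]
  refine IntegrableOn.union ?_ ?_
  · have h1 : IntegrableOn (fun t : ℝ => l * t ^ (-b)) (Set.Ioc 0 1) := by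
      refine Integrable.const_mul ?_ _
      have := intervalIntegral.intervalIntegrable_rpow' (a := 0) (b := 1) (r := -b) (by linarith)
      rwa [intervalIntegrable_iff_integrableOn_Ioc_of_le zero_le_one] at this
    refine h1.mono' hm.aestronglyMeasurable ?_
    refine (ae_restrict_iff' measurableSet_Ioc).2 (ae_of_all _ fun t ht => ?_)
    have ht0 : 0 < t := ht.1
    have h0 : 0 ≤ 1 - rexp (-(t * l)) := by
      have : rexp (-(t * l)) ≤ 1 := exp_le_one_iff.2 (by nlinarith)
      linarith
    rw [norm_of_nonneg (by positivity)]
    calc t ^ (-b - 1) * (1 - rexp (-(t * l))) ≤ t ^ (-b - 1) * (t * l) := by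
          gcongr; exact one_sub_exp_neg_le
      _ = l * t ^ (-b) := by
          rw [rpow_sub_one ht0.ne']; field_simp
  · have h1 : IntegrableOn (fun t : ℝ => t ^ (-b - 1)) (Set.Ioi 1) :=
      integrableOn_Ioi_rpow_of_lt (by linarith) one_pos
    refine h1.mono' hm.aestronglyMeasurable ?_
    refine (ae_restrict_iff' measurableSet_Ioi).2 (ae_of_all _ fun t ht => ?_)
    have ht0 : (0 : ℝ) < t := lt_trans one_pos ht
    have h0 : 0 ≤ 1 - rexp (-(t * l)) := by
      have : rexp (-(t * l)) ≤ 1 := exp_le_one_iff.2 (by nlinarith)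
      linarith
    rw [norm_of_nonneg (by positivity)]
    have := exp_pos (-(t * l))
    exact mul_le_of_le_one_right (by positivity) (by linarith)

lemma integral_rpow_mul_one_sub_exp {b l : ℝ} (hb : 0 < b) (hb1 : b < 1) (hl : 0 < l) :
    ∫ t in Set.Ioi (0 : ℝ), t ^ (-b - 1) * (1 - rexp (-(t * l))) = l ^ b * (Gamma (1 - b) / b) := by
  have hI := integrableOn_rpow_mul_one_sub_exp hb hb1 hl.le
  have hG := integral_rpow_mul_exp_neg_mul_Ioi (a := 1 - b) (r := l) (by linarith) hl
  have hGi : IntegrableOn (fun t : ℝ => t ^ ((1 - b) - 1) * rexp (-(l * t))) (Set.Ioi 0) := by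
    refine .of_integral_ne_zero ?_
    rw [hG]
    have := Gamma_pos_of_pos (show 0 < 1 - b by linarith)
    positivity
  have hle : ∀ t : ℝ, 0 < t → 0 ≤ t ^ (-b) * (1 - rexp (-(t * l))) := fun t ht => by
    have : rexp (-(t * l)) ≤ 1 := exp_le_one_iff.2 (by nlinarith)
    have : 0 ≤ 1 - rexp (-(t * l)) := by linarith
    positivity
  have key := integral_Ioi_of_hasDerivAt_of_tendsto (a := 0) (m := 0)
    (f := fun t : ℝ => t ^ (-b) * (1 - rexp (-(t * l))))
    (f' := fun t : ℝ => (-b) * (t ^ (-b - 1) * (1 - rexp (-(t * l))))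
      + l * (t ^ ((1 - b) - 1) * rexp (-(l * t)))) ?_ ?_ ?_ ?_
  · rw [integral_add (hI.const_mul _) (hGi.const_mul _), integral_const_mul, integral_const_mul,
      hG] at key
    simp only [zero_mul, neg_zero, Real.exp_zero, sub_self, mul_zero] at key
    have h3 : l * (1 / l) ^ (1 - b) = l ^ b := by
      rw [one_div, inv_rpow hl.le, rpow_sub hl, rpow_one]; field_simp
    have h4 : b * ∫ t in Set.Ioi (0 : ℝ), t ^ (-b - 1) * (1 - rexp (-(t * l)))
        = l ^ b * Gamma (1 - b) := by
      rw [← h3]; linarith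
    rw [← mul_div_assoc, eq_div_iff hb.ne', ← h4]; ring
  · refine ContinuousWithinAt.mono_of_mem_nhdsWithin (s := Set.Ici 0) ?_ self_mem_nhdsWithin
    have h0 : Tendsto (fun t : ℝ => l * t ^ (1 - b)) (𝓝[Set.Ici 0] 0) (𝓝 0) := by
      have : ContinuousAt (fun t : ℝ => l * t ^ (1 - b)) 0 :=
        (continuousAt_rpow_const _ _ (Or.inr (by linarith))).const_mul l
      have h5 := this.tendsto.mono_left (nhdsWithin_le_nhds (s := Set.Ici 0))
      simpa [zero_rpow (show 1 - b ≠ 0 by linarith)] using h5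
    unfold ContinuousWithinAt
    simp only [zero_mul, neg_zero, Real.exp_zero, sub_self, mul_zero]
    refine tendsto_of_tendsto_of_tendsto_of_le_of_le' tendsto_const_nhds h0 ?_ ?_
    · filter_upwards [self_mem_nhdsWithin] with t ht
      rcases (show (0 : ℝ) ≤ t from ht).eq_or_lt with rfl | h
      · simp
      · exact hle t h
    · filter_upwards [self_mem_nhdsWithin] with t ht
      rcases (show (0 : ℝ) ≤ t from ht).eq_or_lt with rfl | h
      · simp [zero_rpow (show 1 - b ≠ 0 by linarith)]
      · calc t ^ (-b) * (1 - rexp (-(t * l))) ≤ t ^ (-b) * (t * l) := by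
              gcongr; exact one_sub_exp_neg_le
          _ = l * t ^ (1 - b) := by
              rw [rpow_neg h.le, rpow_sub h, rpow_one]; field_simp
  · intro t ht
    have ht0 : (0 : ℝ) < t := ht
    have h1 : HasDerivAt (fun t : ℝ => t ^ (-b)) (-b * t ^ (-b - 1)) t :=
      hasDerivAt_rpow_const (Or.inl ht0.ne')
    have h2 : HasDerivAt (fun t : ℝ => 1 - rexp (-(t * l))) (-(rexp (-(t * l)) * (-(1 * l)))) t :=
      ((((hasDerivAt_id t).mul_const l).neg).exp).const_sub 1
    convert! h1.mul h2 using 1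
    rw [show 1 - b - 1 = -b by ring, mul_comm l t]; ring
  · exact (hI.const_mul _).add (hGi.const_mul _)
  · refine tendsto_of_tendsto_of_tendsto_of_le_of_le' tendsto_const_nhds
      (tendsto_rpow_neg_atTop hb) ?_ ?_
    · filter_upwards [eventually_gt_atTop 0] with t ht using hle t ht
    · filter_upwards [eventually_gt_atTop 0] with t ht
      have := exp_pos (-(t * l))
      exact mul_le_of_le_one_right (by positivity) (by linarith)

section Gaussian

variable {N : ℕ}

local notation "E" => EuclideanSpace ℝ (Fin N)

lemma integrable_exp_neg_mul_norm_sq {b : ℝ} (hb : 0 < b) :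
    Integrable fun v : E => rexp (-b * ‖v‖ ^ 2) := by
  refine .of_integral_ne_zero ?_
  rw [GaussianFourier.integral_rexp_neg_mul_sq_norm hb]
  positivity

lemma integrable_exp_neg_mul_norm_sq_mul_cos {b : ℝ} (hb : 0 < b) (x : E) :
    Integrable fun v : E => rexp (-b * ‖v‖ ^ 2) * cos (inner ℝ x v) := by
  refine (integrable_exp_neg_mul_norm_sq hb).mul_bdd (c := 1) (by fun_prop) ?_
  exact ae_of_all _ fun v => abs_cos_le_one _

lemma integral_exp_neg_mul_norm_sq_mul_cos {b : ℝ} (hb : 0 < b) (x : E) :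
    ∫ v : E, rexp (-b * ‖v‖ ^ 2) * cos (inner ℝ x v)
      = (π / b) ^ ((N : ℝ) / 2) * rexp (-(‖x‖ ^ 2 / (4 * b))) := by
  have hb' : 0 < (b : ℂ).re := by simpa
  have h := GaussianFourier.integral_cexp_neg_mul_sq_norm_add hb' Complex.I x
  have hi := GaussianFourier.integrable_cexp_neg_mul_sq_norm_add hb' Complex.I x
  have h1 := congrArg Complex.re h
  rw [← RCLike.re_eq_complex_re, ← integral_re hi] at h1
  convert! h1 using 1
  · refine integral_congr_ae (ae_of_all _ fun v => ?_)
    simp only [RCLike.re_eq_complex_re, Complex.exp_re]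
    congr 2 <;> simp [← Complex.ofReal_pow]
  · have : ((π : ℂ) / (b : ℂ)) ^ ((Module.finrank ℝ E : ℂ) / 2)
        * Complex.exp (Complex.I ^ 2 * (‖x‖ : ℂ) ^ 2 / (4 * (b : ℂ)))
        = (((π / b) ^ ((N : ℝ) / 2) * rexp (-(‖x‖ ^ 2 / (4 * b))) : ℝ) : ℂ) := by
      rw [← Complex.ofReal_div]
      push_cast
      rw [Complex.ofReal_cpow (by positivity)]
      simp [neg_div]
    rw [this, RCLike.re_eq_complex_re, Complex.ofReal_re]

end Gaussian

section Symbol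

variable {N : ℕ}

local notation "E" => EuclideanSpace ℝ (Fin N)

lemma one_sub_cos_nonneg (x : ℝ) : 0 ≤ 1 - cos x := by linarith [cos_le_one x]

lemma integral_gaussian_mul_one_sub_cos {t : ℝ} (ht : 0 < t) (ξ : E) :
    ∫ z : E, rexp (-(‖z‖ ^ 2 / 4 / t)) * (1 - cos (inner ℝ ξ z))
      = (4 * π * t) ^ ((N : ℝ) / 2) * (1 - rexp (-(t * ‖ξ‖ ^ 2))) := by
  have hb : 0 < 1 / (4 * t) := by positivity
  have h0 := integral_exp_neg_mul_norm_sq_mul_cos hb (0 : E)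
  have h1 := integral_exp_neg_mul_norm_sq_mul_cos hb ξ
  have i0 := integrable_exp_neg_mul_norm_sq_mul_cos hb (0 : E)
  have i1 := integrable_exp_neg_mul_norm_sq_mul_cos hb ξ
  have hr : π / (1 / (4 * t)) = 4 * π * t := by field_simp
  have hx : ‖ξ‖ ^ 2 / (4 * (1 / (4 * t))) = t * ‖ξ‖ ^ 2 := by field_simp
  rw [hr] at h0 h1
  rw [hx] at h1
  calc _ = ∫ z : E, (rexp (-(1 / (4 * t)) * ‖z‖ ^ 2) * cos (inner ℝ 0 z)
        - rexp (-(1 / (4 * t)) * ‖z‖ ^ 2) * cos (inner ℝ ξ z)) := by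
        refine integral_congr_ae (ae_of_all _ fun z => ?_)
        have : -(‖z‖ ^ 2 / 4 / t) = -(1 / (4 * t)) * ‖z‖ ^ 2 := by field_simp
        simp only [inner_zero_left, cos_zero, this]; ring
    _ = _ := by
        rw [integral_sub i0 i1, h0, h1]
        simp; ring

lemma integrable_gaussian_mul_one_sub_cos {t : ℝ} (ht : 0 < t) (ξ : E) :
    Integrable fun z : E => rexp (-(‖z‖ ^ 2 / 4 / t)) * (1 - cos (inner ℝ ξ z)) := by
  have hb : 0 < 1 / (4 * t) := by positivity
  have i0 := integrable_exp_neg_mul_norm_sq_mul_cos hb (0 : E)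
  have i1 := integrable_exp_neg_mul_norm_sq_mul_cos hb ξ
  refine (i0.sub i1).congr (ae_of_all _ fun z => ?_)
  have : -(‖z‖ ^ 2 / 4 / t) = -(1 / (4 * t)) * ‖z‖ ^ 2 := by field_simp
  simp only [Pi.sub_apply, inner_zero_left, cos_zero, this]; ring

/-- Subordination of the Lévy kernel to the heat kernel: the symbol of `-Δ^{α/2}` is `‖ξ‖^α`. -/
lemma fracLapCoeff_mul_integral_one_sub_cos (hN : 0 < N) {α : ℝ} (hα1 : 0 < α) (hα2 : α < 2)
    (ξ : E) :
    Integrable (fun z : E => (1 - cos (inner ℝ ξ z)) / ‖z‖ ^ ((N : ℝ) + α)) ∧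
    fracLapCoeff N α * ∫ z : E, (1 - cos (inner ℝ ξ z)) / ‖z‖ ^ ((N : ℝ) + α) = ‖ξ‖ ^ α := by
  have : Nonempty (Fin N) := ⟨⟨0, hN⟩⟩
  set a : ℝ := (N : ℝ) / 2 + α / 2 with ha
  have ha0 : 0 < a := by positivity
  set F : E × ℝ → ℝ := fun p =>
    p.2 ^ (-a - 1) * (rexp (-(‖p.1‖ ^ 2 / 4 / p.2)) * (1 - cos (inner ℝ ξ p.1))) with hF
  have hFm : Measurable F := by
    have h1 : Measurable fun p : E × ℝ => inner ℝ ξ p.1 := by fun_prop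
    fun_prop
  set ν : Measure ℝ := volume.restrict (Set.Ioi 0)
  have hpow : ∀ t : ℝ, 0 < t → t ^ (-a - 1) * (4 * π * t) ^ ((N : ℝ) / 2)
      = (4 * π) ^ ((N : ℝ) / 2) * t ^ (-(α / 2) - 1) := fun t ht => by
    rw [mul_rpow (by positivity) ht.le, mul_left_comm, ← rpow_add ht]
    congr 2; rw [ha]; ring
  have hin : ∀ t : ℝ, 0 < t → ∫ z : E, F (z, t)
      = (4 * π) ^ ((N : ℝ) / 2) * (t ^ (-(α / 2) - 1) * (1 - rexp (-(t * ‖ξ‖ ^ 2)))) := fun t ht => by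
    simp only [hF]
    rw [integral_const_mul, integral_gaussian_mul_one_sub_cos ht, ← mul_assoc, hpow t ht, mul_assoc]
  have hFi : Integrable F (volume.prod ν) := by
    rw [integrable_prod_iff' hFm.aestronglyMeasurable]
    constructor
    · refine (ae_restrict_iff' measurableSet_Ioi).2 (ae_of_all _ fun t ht => ?_)
      exact (integrable_gaussian_mul_one_sub_cos ht ξ).const_mul (t ^ (-a - 1))
    · refine (((integrableOn_rpow_mul_one_sub_exp (b := α / 2) (by positivity) (by linarith)
        (sq_nonneg ‖ξ‖)).const_mul ((4 * π) ^ ((N : ℝ) / 2)))).congr ?_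
      refine (ae_restrict_iff' measurableSet_Ioi).2 (ae_of_all _ fun t ht => ?_)
      have ht0 : (0 : ℝ) < t := ht
      refine (hin t ht0).symm.trans ?_
      refine integral_congr_ae (ae_of_all _ fun z => (norm_of_nonneg ?_).symm)
      have := one_sub_cos_nonneg (inner ℝ ξ z)
      positivity
  have hout : ∀ᵐ z : E, ∫ t, F (z, t) ∂ν
      = (4 ^ a * Gamma a) * ((1 - cos (inner ℝ ξ z)) / ‖z‖ ^ ((N : ℝ) + α)) := by
    filter_upwards [Measure.ae_ne volume (0 : E)] with z hz
    have hz' : 0 < ‖z‖ := norm_pos_iff.2 hz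
    simp only [hF, ← mul_assoc]
    rw [integral_mul_const, integral_rpow_mul_exp_neg_div_Ioi ha0 (by positivity)]
    have : (1 / (‖z‖ ^ 2 / 4)) ^ a = 4 ^ a / ‖z‖ ^ ((N : ℝ) + α) := by
      rw [one_div_div, div_rpow (by norm_num) (by positivity), ← rpow_natCast, ← rpow_mul hz'.le]
      congr 2; push_cast; rw [ha]; ring
    rw [this]; ring
  have hG := Gamma_pos_of_pos ha0
  have hC : 0 < 4 ^ a * Gamma a := by positivity
  have hi1 : Integrable fun z : E =>
      (4 ^ a * Gamma a) * ((1 - cos (inner ℝ ξ z)) / ‖z‖ ^ ((N : ℝ) + α)) :=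
    hFi.integral_prod_left.congr hout
  have hi2 : Integrable fun z : E => (1 - cos (inner ℝ ξ z)) / ‖z‖ ^ ((N : ℝ) + α) := by
    refine (hi1.const_mul (4 ^ a * Gamma a)⁻¹).congr (ae_of_all _ fun z => ?_)
    simp only; rw [inv_mul_cancel_left₀ hC.ne']
  refine ⟨hi2, ?_⟩
  have hswap := integral_integral_swap (f := fun (z : E) (t : ℝ) => F (z, t)) hFi
  rw [integral_congr_ae hout, integral_const_mul] at hswap
  have hlast : ∫ t, (∫ z : E, F (z, t)) ∂ν
      = (4 * π) ^ ((N : ℝ) / 2) * (‖ξ‖ ^ α * (Gamma (1 - α / 2) / (α / 2))) := by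
    rw [setIntegral_congr_fun measurableSet_Ioi (fun t ht => hin t ht), integral_const_mul]
    congr 1
    rcases (norm_nonneg ξ).eq_or_lt with h | h
    · simp [← h, zero_rpow hα1.ne']
    · rw [integral_rpow_mul_one_sub_exp (by positivity) (by linarith) (by positivity),
        ← rpow_natCast, ← rpow_mul h.le]
      congr 2; push_cast; ring
  rw [hlast] at hswap
  have hGneg : |Gamma (-α / 2)| = Gamma (1 - α / 2) / (α / 2) := by
    have h1 := Gamma_add_one (s := -α / 2) (by intro h; linarith)
    have h2 : 0 < Gamma (1 - α / 2) := Gamma_pos_of_pos (by linarith)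
    rw [show -α / 2 + 1 = 1 - α / 2 by ring] at h1
    have h3 : Gamma (-α / 2) = -(Gamma (1 - α / 2) / (α / 2)) := by
      rw [h1]; field_simp
    rw [h3, abs_neg, abs_of_pos (by positivity)]
  have h2 : 0 < Gamma (1 - α / 2) := Gamma_pos_of_pos (by linarith)
  have hJ : ∫ z : E, (1 - cos (inner ℝ ξ z)) / ‖z‖ ^ ((N : ℝ) + α)
      = (4 * π) ^ ((N : ℝ) / 2) * (‖ξ‖ ^ α * (Gamma (1 - α / 2) / (α / 2)))
        / (4 ^ a * Gamma a) := by
    rw [eq_div_iff hC.ne', mul_comm, hswap]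
  rw [hJ, fracLapCoeff, hGneg, show ((N : ℝ) + α) / 2 = a by rw [ha]; ring,
    show (2 : ℝ) ^ α = 4 ^ (α / 2) by
      rw [show (4 : ℝ) = 2 ^ (2 : ℝ) by norm_num, ← rpow_mul (by norm_num)]; congr 1; ring,
    show -(N : ℝ) / 2 = -((N : ℝ) / 2) by ring, rpow_neg pi_pos.le,
    mul_rpow (by norm_num) pi_pos.le, ha, rpow_add (by norm_num)]
  have h4 : (0 : ℝ) < 4 ^ (α / 2) := by positivity
  have h5 : (0 : ℝ) < 4 ^ ((N : ℝ) / 2) := by positivity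
  have h6 : (0 : ℝ) < π ^ ((N : ℝ) / 2) := by positivity
  rw [ha] at hG
  generalize Gamma (1 - α / 2) = g at h2
  field_simp

lemma fracLapCoeff_pos (N : ℕ) {α : ℝ} (hα1 : 0 < α) (hα2 : α < 2) : 0 < fracLapCoeff N α := by
  have h1 : Gamma (-α / 2) ≠ 0 := by
    have h1 := Gamma_add_one (s := -α / 2) (by intro h; linarith)
    have h2 : 0 < Gamma (-α / 2 + 1) := Gamma_pos_of_pos (by linarith)
    intro h
    rw [h1, h, mul_zero] at h2
    exact lt_irrefl _ h2
  have h2 : 0 < Gamma (((N : ℝ) + α) / 2) := Gamma_pos_of_pos (by positivity)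
  unfold fracLapCoeff
  positivity

end Symbol

/-- The heat kernel `p_t(x) = (4πt)^{-N/2} exp(-‖x‖²/(4t))`. -/
def heatKernel (N : ℕ) (t : ℝ) (x : EuclideanSpace ℝ (Fin N)) : ℝ :=
  (4 * π * t) ^ (-((N : ℝ) / 2)) * rexp (-(‖x‖ ^ 2 / 4 / t))

/-- The Riesz kernel mollified by the heat kernel at time `ε`, defined through its Fourier
transform. -/
def mollifiedRiesz (N : ℕ) (α ε : ℝ) (x : EuclideanSpace ℝ (Fin N)) : ℝ :=
  ((2 * π) ^ N)⁻¹ * ∫ ξ : EuclideanSpace ℝ (Fin N),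
    ‖ξ‖ ^ (-α) * rexp (-ε * ‖ξ‖ ^ 2) * cos (inner ℝ x ξ)

section Riesz

variable {N : ℕ}

local notation "E" => EuclideanSpace ℝ (Fin N)

lemma heatKernel_nonneg {t : ℝ} (ht : 0 ≤ t) (x : E) : 0 ≤ heatKernel N t x := by
  unfold heatKernel; positivity

lemma two_pi_pow_inv_mul {t : ℝ} (ht : 0 < t) :
    ((2 * π) ^ N)⁻¹ * (π / t) ^ ((N : ℝ) / 2) = (4 * π * t) ^ (-((N : ℝ) / 2)) := by
  have h : ((2 * π) ^ N : ℝ) = (4 * π * π) ^ ((N : ℝ) / 2) := by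
    rw [show (4 * π * π) = (2 * π) ^ (2 : ℝ) by rw [rpow_two]; ring, ← rpow_mul (by positivity),
      ← rpow_natCast]
    congr 1; ring
  rw [h, ← inv_rpow (by positivity), ← mul_rpow (by positivity) (by positivity),
    rpow_neg (by positivity), ← inv_rpow (by positivity)]
  congr 1; field_simp

lemma heatKernel_eq_integral {t : ℝ} (ht : 0 < t) (x : E) :
    heatKernel N t x
      = ((2 * π) ^ N)⁻¹ * ∫ ξ : E, rexp (-t * ‖ξ‖ ^ 2) * cos (inner ℝ x ξ) := by
  rw [integral_exp_neg_mul_norm_sq_mul_cos ht, ← mul_assoc, two_pi_pow_inv_mul ht, heatKernel]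
  congr 3; field_simp

lemma integrable_heatKernel {t : ℝ} (ht : 0 < t) : Integrable (heatKernel N t) := by
  refine ((integrable_exp_neg_mul_norm_sq (N := N) (b := 1 / (4 * t)) (by positivity)).const_mul
    ((4 * π * t) ^ (-((N : ℝ) / 2)))).congr (ae_of_all _ fun x => ?_)
  simp only [heatKernel]
  congr 2; field_simp

lemma integral_heatKernel {t : ℝ} (ht : 0 < t) : ∫ x : E, heatKernel N t x = 1 := by
  have h := GaussianFourier.integral_rexp_neg_mul_sq_norm (V := E) (b := 1 / (4 * t)) (by positivity)
  have h2 : ∀ x : E, heatKernel N t x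
      = (4 * π * t) ^ (-((N : ℝ) / 2)) * rexp (-(1 / (4 * t)) * ‖x‖ ^ 2) := fun x => by
    simp only [heatKernel]
    congr 2; field_simp
  simp only [h2]
  rw [integral_const_mul, h, show π / (1 / (4 * t)) = 4 * π * t by field_simp,
    finrank_euclideanSpace_fin, ← rpow_add (by positivity)]
  simp

lemma integrable_norm_rpow_mul_exp (hN : 0 < N) {s ε : ℝ} (hs : -(N : ℝ) < s) (hε : 0 < ε) :
    Integrable fun ξ : E => ‖ξ‖ ^ s * rexp (-ε * ‖ξ‖ ^ 2) := by
  have : Nonempty (Fin N) := ⟨⟨0, hN⟩⟩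
  refine (integrable_fun_norm_addHaar (volume : Measure E)
    (f := fun r : ℝ => r ^ s * rexp (-ε * r ^ 2))).2 ?_
  have h := integrableOn_rpow_mul_exp_neg_mul_sq hε (s := (N : ℝ) - 1 + s) (by linarith)
  refine h.congr_fun (fun r hr => ?_) measurableSet_Ioi
  have hr0 : (0 : ℝ) < r := hr
  simp only [smul_eq_mul, finrank_euclideanSpace_fin]
  rw [rpow_add hr0, ← rpow_natCast r (N - 1), Nat.cast_pred hN]
  ring

lemma integrable_norm_rpow_mul_exp_mul_cos (hN : 0 < N) {s ε : ℝ} (hs : -(N : ℝ) < s) (hε : 0 < ε)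
    (x : E) : Integrable fun ξ : E => ‖ξ‖ ^ s * rexp (-ε * ‖ξ‖ ^ 2) * cos (inner ℝ x ξ) := by
  refine (integrable_norm_rpow_mul_exp hN hs hε).mul_bdd (c := 1) (by fun_prop) ?_
  exact ae_of_all _ fun v => abs_cos_le_one _

lemma mollifiedRiesz_second_difference (hN : 3 ≤ N) {α ε : ℝ} (hα2 : α < 2)
    (hε : 0 < ε) (x z : E) :
    mollifiedRiesz N α ε (x + z) + mollifiedRiesz N α ε (x - z) - 2 * mollifiedRiesz N α ε x
      = -(2 * ((2 * π) ^ N)⁻¹) * ∫ ξ : E, ‖ξ‖ ^ (-α) * rexp (-ε * ‖ξ‖ ^ 2) * cos (inner ℝ x ξ)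
          * (1 - cos (inner ℝ ξ z)) := by
  have hN0 : 0 < N := by omega
  have hN3 : (3 : ℝ) ≤ N := by exact_mod_cast hN
  have hi := fun y : E => integrable_norm_rpow_mul_exp_mul_cos hN0 (s := -α) (by linarith) hε y
  have h1 : (fun ξ : E => ‖ξ‖ ^ (-α) * rexp (-ε * ‖ξ‖ ^ 2) * cos (inner ℝ x ξ)
          * (1 - cos (inner ℝ ξ z)))
      = fun ξ : E => (‖ξ‖ ^ (-α) * rexp (-ε * ‖ξ‖ ^ 2) * cos (inner ℝ x ξ))
        - 2⁻¹ * (‖ξ‖ ^ (-α) * rexp (-ε * ‖ξ‖ ^ 2) * cos (inner ℝ (x + z) ξ)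
          + ‖ξ‖ ^ (-α) * rexp (-ε * ‖ξ‖ ^ 2) * cos (inner ℝ (x - z) ξ)) := by
    funext ξ
    rw [inner_add_left, inner_sub_left, cos_add, cos_sub, real_inner_comm ξ z]
    ring
  have hadd : Integrable fun ξ : E => ‖ξ‖ ^ (-α) * rexp (-ε * ‖ξ‖ ^ 2) * cos (inner ℝ (x + z) ξ)
      + ‖ξ‖ ^ (-α) * rexp (-ε * ‖ξ‖ ^ 2) * cos (inner ℝ (x - z) ξ) := (hi _).add (hi _)
  rw [h1, integral_sub (hi x) (hadd.const_mul 2⁻¹), integral_const_mul,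
    integral_add (hi _) (hi _)]
  simp only [mollifiedRiesz]
  ring

lemma fracLap_mollifiedRiesz (hN : 3 ≤ N) {α ε : ℝ} (hα1 : 0 < α) (hα2 : α < 2) (hε : 0 < ε)
    (x : E) :
    Integrable (fun z : E => (mollifiedRiesz N α ε (x + z) + mollifiedRiesz N α ε (x - z)
      - 2 * mollifiedRiesz N α ε x) / ‖z‖ ^ ((N : ℝ) + α)) ∧
    fracLap N α (mollifiedRiesz N α ε) x = -heatKernel N ε x := by
  have hN0 : 0 < N := by omega
  have : Nonempty (Fin N) := ⟨⟨0, hN0⟩⟩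
  have hc := fracLapCoeff_pos N hα1 hα2
  set c := fracLapCoeff N α with hcdef
  have hL := fun ξ : E => fracLapCoeff_mul_integral_one_sub_cos hN0 hα1 hα2 ξ
  have hJ : ∀ ξ : E, ∫ z : E, (1 - cos (inner ℝ ξ z)) / ‖z‖ ^ ((N : ℝ) + α) = c⁻¹ * ‖ξ‖ ^ α :=
    fun ξ => by rw [← (hL ξ).2, inv_mul_cancel_left₀ hc.ne']
  set G : E × E → ℝ := fun p => (‖p.2‖ ^ (-α) * rexp (-ε * ‖p.2‖ ^ 2) * cos (inner ℝ x p.2))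
    * ((1 - cos (inner ℝ p.2 p.1)) / ‖p.1‖ ^ ((N : ℝ) + α)) with hG
  have hGm : Measurable G := by
    have h1 : Measurable fun p : E × E => inner ℝ x p.2 := by fun_prop
    have h2 : Measurable fun p : E × E => inner ℝ p.2 p.1 := by fun_prop
    fun_prop
  have hmul : ∀ᵐ ξ : E, ‖ξ‖ ^ (-α) * ‖ξ‖ ^ α = 1 := by
    filter_upwards [Measure.ae_ne volume (0 : E)] with ξ hξ
    have := norm_pos_iff.2 hξ
    rw [← rpow_add this]; simp
  have hGi : Integrable G (volume.prod volume) := by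
    rw [integrable_prod_iff' hGm.aestronglyMeasurable]
    refine ⟨ae_of_all _ fun ξ => (hL ξ).1.const_mul
      (‖ξ‖ ^ (-α) * rexp (-ε * ‖ξ‖ ^ 2) * cos (inner ℝ x ξ)), ?_⟩
    refine ((integrable_exp_neg_mul_norm_sq_mul_cos hε x).norm.const_mul c⁻¹).congr ?_
    filter_upwards [hmul] with ξ hξ
    have h1 : ∀ z : E, ‖G (z, ξ)‖ = (‖ξ‖ ^ (-α) * (rexp (-ε * ‖ξ‖ ^ 2) * |cos (inner ℝ x ξ)|))
        * ((1 - cos (inner ℝ ξ z)) / ‖z‖ ^ ((N : ℝ) + α)) := fun z => by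
      have h2 := one_sub_cos_nonneg (inner ℝ ξ z)
      have h3 : 0 ≤ (1 - cos (inner ℝ ξ z)) / ‖z‖ ^ ((N : ℝ) + α) := by positivity
      simp only [hG]
      rw [norm_mul, norm_of_nonneg h3, norm_mul, norm_of_nonneg (by positivity), Real.norm_eq_abs,
        mul_assoc (‖ξ‖ ^ (-α))]
    simp only [h1]
    rw [integral_const_mul, hJ, norm_mul, norm_of_nonneg (exp_pos _).le, Real.norm_eq_abs]
    linear_combination -(c⁻¹ * rexp (-ε * ‖ξ‖ ^ 2) * |cos (inner ℝ x ξ)|) * hξ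
  have hD : ∀ z : E, (mollifiedRiesz N α ε (x + z) + mollifiedRiesz N α ε (x - z)
      - 2 * mollifiedRiesz N α ε x) / ‖z‖ ^ ((N : ℝ) + α)
      = -(2 * ((2 * π) ^ N)⁻¹) * ∫ ξ : E, G (z, ξ) := fun z => by
    rw [mollifiedRiesz_second_difference hN hα2 hε, mul_div_assoc, ← integral_div]
    congr 2; funext ξ; simp only [hG]; ring
  simp only [fracLap, hD]
  refine ⟨hGi.integral_prod_left.const_mul _, ?_⟩
  rw [integral_const_mul, integral_integral_swap (f := fun (z ξ : E) => G (z, ξ)) hGi,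
    heatKernel_eq_integral hε]
  have h4 : ∫ ξ : E, ∫ z : E, G (z, ξ)
      = c⁻¹ * ∫ ξ : E, rexp (-ε * ‖ξ‖ ^ 2) * cos (inner ℝ x ξ) := by
    rw [← integral_const_mul]
    refine integral_congr_ae ?_
    filter_upwards [hmul] with ξ hξ
    simp only [hG]
    rw [integral_const_mul, hJ]
    linear_combination (c⁻¹ * rexp (-ε * ‖ξ‖ ^ 2) * cos (inner ℝ x ξ)) * hξ
  rw [h4, ← hcdef]
  field_simp

lemma mollifiedRiesz_eq_re_fourier (hN : 3 ≤ N) {α ε : ℝ} (hα2 : α < 2)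
    (hε : 0 < ε) (x : E) :
    mollifiedRiesz N α ε x = ((2 * π) ^ N)⁻¹ * (∫ ξ : E, Real.fourierChar
      (-(inner ℝ ξ ((2 * π)⁻¹ • x))) • ((‖ξ‖ ^ (-α) * rexp (-ε * ‖ξ‖ ^ 2) : ℝ) : ℂ)).re := by
  have hN0 : 0 < N := by omega
  have hN3 : (3 : ℝ) ≤ N := by exact_mod_cast hN
  have hi : Integrable fun ξ : E => ((‖ξ‖ ^ (-α) * rexp (-ε * ‖ξ‖ ^ 2) : ℝ) : ℂ) :=
    (integrable_norm_rpow_mul_exp hN0 (s := -α) (by linarith) hε).ofReal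
  have hi2 := (Real.fourierIntegral_convergent_iff ((2 * π)⁻¹ • x)).2 hi
  rw [← RCLike.re_eq_complex_re, ← integral_re hi2, mollifiedRiesz]
  congr 1
  refine integral_congr_ae (ae_of_all _ fun ξ => ?_)
  simp only [RCLike.re_eq_complex_re]
  rw [Circle.smul_def, Real.fourierChar_apply, smul_eq_mul, Complex.re_mul_ofReal,
    Complex.exp_ofReal_mul_I_re, inner_smul_right, real_inner_comm ξ x, mul_comm]
  congr 1
  rw [← cos_neg]; congr 1; field_simp

lemma contDiff_mollifiedRiesz (hN : 3 ≤ N) {α ε : ℝ} (hα2 : α < 2) (hε : 0 < ε) :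
    ContDiff ℝ (⊤ : ℕ∞) (mollifiedRiesz N α ε) := by
  have hN0 : 0 < N := by omega
  have hN3 : (3 : ℝ) ≤ N := by exact_mod_cast hN
  have : Nonempty (Fin N) := ⟨⟨0, hN0⟩⟩
  have h := Real.contDiff_fourier (N := ⊤) (V := E)
    (f := fun ξ : E => ((‖ξ‖ ^ (-α) * rexp (-ε * ‖ξ‖ ^ 2) : ℝ) : ℂ)) ?_
  · have h2 : ContDiff ℝ (⊤ : ℕ∞) fun x : E => (2 * π)⁻¹ • x := contDiff_const_smul _
    have h3 := (Complex.reCLM.contDiff.comp (h.comp h2)).const_smul (((2 * π) ^ N)⁻¹)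
    convert! h3 using 1
    funext x
    rw [mollifiedRiesz_eq_re_fourier hN hα2 hε]
    rfl
  · intro n _
    refine (integrable_norm_rpow_mul_exp hN0 (s := n - α) ?_ hε).congr ?_
    · have : (0 : ℝ) ≤ n := n.cast_nonneg
      linarith
    · filter_upwards [Measure.ae_ne volume (0 : E)] with ξ hξ
      have := norm_pos_iff.2 hξ
      rw [Complex.norm_real, norm_of_nonneg (by positivity), sub_eq_add_neg, rpow_add this,
        rpow_natCast]
      ring

lemma tendsto_mollifiedRiesz_cocompact (hN : 3 ≤ N) {α ε : ℝ} (hα2 : α < 2) (hε : 0 < ε) :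
    Tendsto (mollifiedRiesz N α ε) (cocompact E) (𝓝 0) := by
  have h := tendsto_integral_exp_inner_smul_cocompact (V := E)
    (fun ξ : E => ((‖ξ‖ ^ (-α) * rexp (-ε * ‖ξ‖ ^ 2) : ℝ) : ℂ))
  have hp : ((2 * π)⁻¹ : ℝ) ≠ 0 := by positivity
  have h2 : Tendsto (fun x : E => (2 * π)⁻¹ • x) (cocompact E) (cocompact E) :=
    (Homeomorph.smulOfNeZero _ hp).isClosedEmbedding.tendsto_cocompact
  have h3 := ((Complex.continuous_re.tendsto 0).comp (h.comp h2)).const_mul (((2 * π) ^ N)⁻¹)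
  simp only [Complex.zero_re, mul_zero] at h3
  refine h3.congr fun x => ?_
  rw [mollifiedRiesz_eq_re_fourier hN hα2 hε]
  rfl

lemma mollifiedRiesz_eq_integral_heatKernel (hN : 3 ≤ N) {α ε : ℝ} (hα1 : 0 < α) (hα2 : α < 2)
    (hε : 0 < ε) (x : E) :
    IntegrableOn (fun s : ℝ => s ^ (α / 2 - 1) / Gamma (α / 2) * heatKernel N (s + ε) x)
      (Set.Ioi 0) ∧
    ∫ s in Set.Ioi (0 : ℝ), s ^ (α / 2 - 1) / Gamma (α / 2) * heatKernel N (s + ε) x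
      = mollifiedRiesz N α ε x := by
  have hN0 : 0 < N := by omega
  have hN3 : (3 : ℝ) ≤ N := by exact_mod_cast hN
  have : Nonempty (Fin N) := ⟨⟨0, hN0⟩⟩
  have hβ : 0 < α / 2 := by positivity
  have hΓ := Gamma_pos_of_pos hβ
  set ν : Measure ℝ := volume.restrict (Set.Ioi 0)
  set G : ℝ × E → ℝ := fun p => (p.1 ^ (α / 2 - 1) * rexp (-(‖p.2‖ ^ 2 * p.1)))
    * (rexp (-ε * ‖p.2‖ ^ 2) * cos (inner ℝ x p.2)) with hG
  have hGm : Measurable G := by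
    have h1 : Measurable fun p : ℝ × E => inner ℝ x p.2 := by fun_prop
    fun_prop
  have hone : ∀ ξ : E, ξ ≠ 0 → ∫ s, s ^ (α / 2 - 1) * rexp (-(‖ξ‖ ^ 2 * s)) ∂ν
      = ‖ξ‖ ^ (-α) * Gamma (α / 2) := fun ξ hξ => by
    have h0 := norm_pos_iff.2 hξ
    rw [integral_rpow_mul_exp_neg_mul_Ioi hβ (by positivity), one_div, inv_rpow (by positivity),
      ← rpow_neg (by positivity), ← rpow_natCast, ← rpow_mul h0.le]
    congr 2; push_cast; ring
  have hGi : Integrable G (ν.prod volume) := by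
    rw [integrable_prod_iff' hGm.aestronglyMeasurable]
    constructor
    · filter_upwards [Measure.ae_ne volume (0 : E)] with ξ hξ
      have h0 := norm_pos_iff.2 hξ
      have h1 : Integrable (fun s : ℝ => s ^ (α / 2 - 1) * rexp (-(‖ξ‖ ^ 2 * s))) ν := by
        refine .of_integral_ne_zero ?_
        rw [hone ξ hξ]; positivity
      exact h1.mul_const (rexp (-ε * ‖ξ‖ ^ 2) * cos (inner ℝ x ξ))
    · refine (((integrable_norm_rpow_mul_exp_mul_cos hN0 (s := -α) (by linarith) hε x).norm).const_mul
        (Gamma (α / 2))).congr ?_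
      filter_upwards [Measure.ae_ne volume (0 : E)] with ξ hξ
      have h1 : ∫ s, ‖G (s, ξ)‖ ∂ν = ∫ s, (s ^ (α / 2 - 1) * rexp (-(‖ξ‖ ^ 2 * s)))
          * ‖rexp (-ε * ‖ξ‖ ^ 2) * cos (inner ℝ x ξ)‖ ∂ν := by
        refine setIntegral_congr_fun measurableSet_Ioi fun s hs => ?_
        have hs0 : (0 : ℝ) < s := hs
        simp only [hG]
        rw [norm_mul, norm_of_nonneg (show 0 ≤ s ^ (α / 2 - 1) * rexp (-(‖ξ‖ ^ 2 * s)) by positivity)]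
      rw [h1, integral_mul_const, hone ξ hξ, mul_assoc (‖ξ‖ ^ (-α)), norm_mul,
        norm_of_nonneg (show 0 ≤ ‖ξ‖ ^ (-α) by positivity)]
      ring
  have hin : ∀ s : ℝ, 0 < s → (∫ ξ : E, G (s, ξ)) * (((2 * π) ^ N)⁻¹ * (Gamma (α / 2))⁻¹)
      = s ^ (α / 2 - 1) / Gamma (α / 2) * heatKernel N (s + ε) x := fun s hs => by
    have h1 : (fun ξ : E => G (s, ξ)) = fun ξ : E => s ^ (α / 2 - 1) *
        (rexp (-(s + ε) * ‖ξ‖ ^ 2) * cos (inner ℝ x ξ)) := by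
      funext ξ
      simp only [hG]
      rw [show -(s + ε) * ‖ξ‖ ^ 2 = -(‖ξ‖ ^ 2 * s) + -ε * ‖ξ‖ ^ 2 by ring, Real.exp_add]
      ring
    rw [h1, integral_const_mul, heatKernel_eq_integral (by positivity)]
    ring
  constructor
  · refine (hGi.integral_prod_left.mul_const (((2 * π) ^ N)⁻¹ * (Gamma (α / 2))⁻¹)).congr ?_
    exact (ae_restrict_iff' measurableSet_Ioi).2 (ae_of_all _ fun s hs => hin s hs)
  · rw [← setIntegral_congr_fun measurableSet_Ioi (fun s hs => hin s hs), integral_mul_const,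
      integral_integral_swap (f := fun (s : ℝ) (ξ : E) => G (s, ξ)) hGi, mollifiedRiesz]
    have h4 : ∫ ξ : E, ∫ s, G (s, ξ) ∂ν = Gamma (α / 2) *
        ∫ ξ : E, ‖ξ‖ ^ (-α) * rexp (-ε * ‖ξ‖ ^ 2) * cos (inner ℝ x ξ) := by
      rw [← integral_const_mul]
      refine integral_congr_ae ?_
      filter_upwards [Measure.ae_ne volume (0 : E)] with ξ hξ
      simp only [hG]
      rw [integral_mul_const, hone ξ hξ]; ring
    rw [h4]; field_simp

lemma integral_heatKernel_eq_riesz (hN : 3 ≤ N) {α : ℝ} (hα2 : α < 2)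
    {x : E} (hx : x ≠ 0) :
    IntegrableOn (fun s : ℝ => s ^ (α / 2 - 1) / Gamma (α / 2) * heatKernel N s x)
      (Set.Ioi 0) ∧
    ∫ s in Set.Ioi (0 : ℝ), s ^ (α / 2 - 1) / Gamma (α / 2) * heatKernel N s x
      = rieszCoeff N α * ‖x‖ ^ (-((N : ℝ) - α)) := by
  have hN3 : (3 : ℝ) ≤ N := by exact_mod_cast hN
  have h0 := norm_pos_iff.2 hx
  have ha : 0 < ((N : ℝ) - α) / 2 := by linarith
  have hq : 0 < ‖x‖ ^ 2 / 4 := by positivity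
  have hE : ∀ s : ℝ, s ∈ Set.Ioi (0 : ℝ) → (4 * π) ^ (-((N : ℝ) / 2)) / Gamma (α / 2) *
      (s ^ (-(((N : ℝ) - α) / 2) - 1) * rexp (-(‖x‖ ^ 2 / 4 / s)))
      = s ^ (α / 2 - 1) / Gamma (α / 2) * heatKernel N s x := fun s hs => by
    have hs0 : (0 : ℝ) < s := hs
    rw [heatKernel, mul_rpow (by positivity) hs0.le,
      show -(((N : ℝ) - α) / 2) - 1 = (α / 2 - 1) + -((N : ℝ) / 2) by ring, rpow_add hs0]
    ring
  constructor
  · exact IntegrableOn.congr_fun ((integrableOn_rpow_mul_exp_neg_div_Ioi ha hq).const_mul _) hE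
      measurableSet_Ioi
  · rw [← setIntegral_congr_fun measurableSet_Ioi hE, integral_const_mul,
      integral_rpow_mul_exp_neg_div_Ioi ha hq, rieszCoeff]
    have h1 : (1 / (‖x‖ ^ 2 / 4)) ^ (((N : ℝ) - α) / 2)
        = 4 ^ ((N : ℝ) / 2) * 2 ^ (-α) * ‖x‖ ^ (-((N : ℝ) - α)) := by
      rw [one_div_div, div_rpow (by norm_num) (by positivity), ← rpow_natCast, ← rpow_mul h0.le,
        rpow_neg h0.le, show ((2 : ℕ) : ℝ) * (((N : ℝ) - α) / 2) = (N : ℝ) - α by push_cast; ring,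
        show (4 : ℝ) = 2 ^ (2 : ℝ) by norm_num, ← rpow_mul (by norm_num), ← rpow_mul (by norm_num),
        ← rpow_add (by norm_num), div_eq_mul_inv]
      congr 2; ring
    rw [h1, mul_rpow (by norm_num) pi_pos.le, show -(N : ℝ) / 2 = -((N : ℝ) / 2) by ring,
      rpow_neg (show (0 : ℝ) ≤ 4 by norm_num)]
    have h4 : (0 : ℝ) < 4 ^ ((N : ℝ) / 2) := by positivity
    field_simp

lemma ofReal_riesz_le_liminf (hN : 3 ≤ N) {α : ℝ} (hα1 : 0 < α) (hα2 : α < 2)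
    {ε : ℕ → ℝ} (hε : ∀ n, 0 < ε n) (hε0 : Tendsto ε atTop (𝓝 0)) {x : E} (hx : x ≠ 0) :
    ENNReal.ofReal (rieszCoeff N α * ‖x‖ ^ (-((N : ℝ) - α)))
      ≤ liminf (fun n => ENNReal.ofReal (mollifiedRiesz N α (ε n) x)) atTop := by
  have hΓ := Gamma_pos_of_pos (show 0 < α / 2 by positivity)
  obtain ⟨hi, he⟩ := integral_heatKernel_eq_riesz hN hα2 hx
  have hnn : ∀ e : ℝ, 0 ≤ e → 0 ≤ᵐ[volume.restrict (Set.Ioi 0)]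
      fun s : ℝ => s ^ (α / 2 - 1) / Gamma (α / 2) * heatKernel N (s + e) x := fun e h =>
    (ae_restrict_iff' measurableSet_Ioi).2 (ae_of_all _ fun s hs => by
      have hs0 : (0 : ℝ) < s := hs
      have := heatKernel_nonneg (show 0 ≤ s + e by positivity) x
      positivity)
  have h0 := hnn 0 le_rfl
  simp only [add_zero] at h0
  rw [← he, ofReal_integral_eq_lintegral_ofReal hi h0]
  simp_rw [fun n => (mollifiedRiesz_eq_integral_heatKernel hN hα1 hα2 (hε n) x).2.symm,
    fun n => ofReal_integral_eq_lintegral_ofReal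
      (mollifiedRiesz_eq_integral_heatKernel hN hα1 hα2 (hε n) x).1 (hnn _ (hε n).le)]
  refine le_trans (lintegral_mono_ae ?_) (lintegral_liminf_le' fun n =>
    (mollifiedRiesz_eq_integral_heatKernel hN hα1 hα2 (hε n) x).1.aestronglyMeasurable.aemeasurable.ennreal_ofReal)
  refine (ae_restrict_iff' measurableSet_Ioi).2 (ae_of_all _ fun s hs => ?_)
  have hs0 : (0 : ℝ) < s := hs
  refine le_of_eq (Tendsto.liminf_eq ?_).symm
  refine (ENNReal.continuous_ofReal.tendsto _).comp (Tendsto.const_mul _ ?_)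
  have hc : ContinuousAt (fun t : ℝ => heatKernel N t x) s := by
    unfold heatKernel
    refine ContinuousAt.mul ?_ ?_
    · exact (continuousAt_const.mul continuousAt_id).rpow_const
        (Or.inl (show 4 * π * s ≠ 0 by positivity))
    · exact (continuousAt_const.div continuousAt_id hs0.ne').neg.rexp
  refine hc.tendsto.comp ?_
  simpa using hε0.const_add s

end Riesz

section TestFunction

variable {N : ℕ}

local notation "E" => EuclideanSpace ℝ (Fin N)

lemma integrable_min_one_norm_sq_div (hN : 0 < N) {α : ℝ} (hα1 : 0 < α) (hα2 : α < 2) :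
    Integrable fun z : E => min 1 (‖z‖ ^ 2) / ‖z‖ ^ ((N : ℝ) + α) := by
  have : Nonempty (Fin N) := ⟨⟨0, hN⟩⟩
  refine (integrable_fun_norm_addHaar (volume : Measure E)
    (f := fun r : ℝ => min 1 (r ^ 2) / r ^ ((N : ℝ) + α))).2 ?_
  have key : ∀ r : ℝ, 0 < r → r ^ (N - 1) • (min 1 (r ^ 2) / r ^ ((N : ℝ) + α))
      = min 1 (r ^ 2) * r ^ (-1 - α) := fun r hr => by
    rw [smul_eq_mul, ← rpow_natCast r (N - 1), Nat.cast_pred hN, div_eq_mul_inv, ← rpow_neg hr.le,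
      mul_left_comm, ← rpow_add hr]
    congr 2; ring
  rw [finrank_euclideanSpace_fin, ← Set.Ioc_union_Ioi_eq_Ioi zero_le_one]
  refine IntegrableOn.union ?_ ?_
  · have h := (intervalIntegrable_iff_integrableOn_Ioc_of_le zero_le_one).1
      (intervalIntegral.intervalIntegrable_rpow' (a := 0) (b := 1) (r := 1 - α) (by linarith))
    refine h.congr_fun (fun r hr => ?_) measurableSet_Ioc
    simp only
    rw [key r hr.1, min_eq_right (pow_le_one₀ hr.1.le hr.2), ← rpow_natCast r 2, ← rpow_add hr.1]
    congr 1; push_cast; ring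
  · have h := integrableOn_Ioi_rpow_of_lt (a := -1 - α) (by linarith) zero_lt_one
    refine h.congr_fun (fun r hr => ?_) measurableSet_Ioi
    have hr1 : (1 : ℝ) < r := hr
    simp only
    rw [key r (by linarith), min_eq_left (one_le_pow₀ hr1.le), one_mul]

lemma abs_second_difference_le {θ : E → ℝ} (hθ : ContDiff ℝ (⊤ : ℕ∞) θ)
    (hc : HasCompactSupport θ) :
    ∃ C : ℝ, 0 ≤ C ∧ ∀ x z : E, |θ (x + z) + θ (x - z) - 2 * θ x| ≤ C * ‖z‖ ^ 2 := by
  have hd : Differentiable ℝ θ := hθ.differentiable (by simp)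
  obtain ⟨K, hK⟩ := (hθ.fderiv_right (m := (⊤ : ℕ∞)) (by simp)).lipschitzWith_of_hasCompactSupport
    (hc.fderiv ℝ) (by simp)
  refine ⟨2 * K, by positivity, fun x z => ?_⟩
  have hg : ∀ w ∈ Metric.closedBall (0 : E) ‖z‖,
      HasFDerivWithinAt (fun w => θ (x + w) + θ (x - w) - 2 * θ x)
        (fderiv ℝ θ (x + w) - fderiv ℝ θ (x - w)) (Metric.closedBall 0 ‖z‖) w := fun w _ => by
    have h1 := (hd (x + w)).hasFDerivAt.comp w ((hasFDerivAt_id w).const_add x)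
    have h2 := (hd (x - w)).hasFDerivAt.comp w ((hasFDerivAt_id w).const_sub x)
    have h3 := ((h1.add h2).sub_const (2 * θ x)).hasFDerivWithinAt (s := Metric.closedBall 0 ‖z‖)
    convert! h3 using 1
    ext v
    simp [sub_eq_add_neg]
  have hb : ∀ w ∈ Metric.closedBall (0 : E) ‖z‖,
      ‖fderiv ℝ θ (x + w) - fderiv ℝ θ (x - w)‖ ≤ 2 * K * ‖z‖ := fun w hw => by
    have h1 := hK.dist_le_mul (x + w) (x - w)
    rw [dist_eq_norm, dist_eq_norm, show x + w - (x - w) = (2 : ℝ) • w by rw [two_smul]; abel,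
      norm_smul] at h1
    have h2 : ‖w‖ ≤ ‖z‖ := by simpa using hw
    have h3 : (K : ℝ) * ‖w‖ ≤ K * ‖z‖ := by gcongr
    have h4 : ‖(2 : ℝ)‖ = 2 := by norm_num
    rw [h4] at h1
    linarith
  have h := (convex_closedBall (0 : E) ‖z‖).norm_image_sub_le_of_norm_hasFDerivWithin_le hg hb
    (Metric.mem_closedBall_self (norm_nonneg z)) (y := z) (by simp)
  simp only [add_zero, sub_zero, Real.norm_eq_abs] at h
  rw [show θ x + θ x - 2 * θ x = 0 by ring, sub_zero] at h
  linarith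

lemma integrable_second_difference {θ : E → ℝ} (hθ : Integrable θ) (z : E) :
    Integrable fun x => θ (x + z) + θ (x - z) - 2 * θ x :=
  ((hθ.comp_add_right z).add (hθ.comp_sub_right z)).sub (hθ.const_mul 2)

lemma integral_second_difference {θ : E → ℝ} (hθ : Integrable θ) (z : E) :
    ∫ x, (θ (x + z) + θ (x - z) - 2 * θ x) = 0 := by
  have h1 : Integrable fun x => θ (x + z) + θ (x - z) :=
    (hθ.comp_add_right z).add (hθ.comp_sub_right z)
  rw [integral_sub h1 (hθ.const_mul 2),
    integral_add (hθ.comp_add_right z) (hθ.comp_sub_right z), integral_const_mul,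
    integral_add_right_eq_self, integral_sub_right_eq_self]
  ring

lemma integral_abs_second_difference_le {θ : E → ℝ} (hθ : ContDiff ℝ (⊤ : ℕ∞) θ)
    (hc : HasCompactSupport θ) :
    ∃ C : ℝ, ∀ z : E, ∫ x, |θ (x + z) + θ (x - z) - 2 * θ x| ≤ C * min 1 (‖z‖ ^ 2) := by
  have hi : Integrable θ := hθ.continuous.integrable_of_hasCompactSupport hc
  obtain ⟨C, hC0, hC⟩ := abs_second_difference_le hθ hc
  obtain ⟨R, hR⟩ := hc.isCompact.isBounded.subset_closedBall (0 : E)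
  have hz0 : ∀ y : E, R < ‖y‖ → θ y = 0 := fun y hy => by
    by_contra h
    have := hR (subset_tsupport θ (Function.mem_support.2 h))
    rw [mem_closedBall_zero_iff] at this
    linarith
  set B := Metric.closedBall (0 : E) (R + 1)
  set V := (volume : Measure E).real B
  have hV : 0 ≤ V := measureReal_nonneg
  set L := ∫ x, |θ x|
  have hL : 0 ≤ L := integral_nonneg fun x => abs_nonneg _
  refine ⟨max (C * V) (4 * L), fun z => ?_⟩
  rcases le_or_gt ‖z‖ 1 with hz | hz
  · rw [min_eq_right (pow_le_one₀ (norm_nonneg z) hz)]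
    have h1 : ∫ x, |θ (x + z) + θ (x - z) - 2 * θ x| ≤ ∫ x, B.indicator (fun _ => C * ‖z‖ ^ 2) x := by
      refine integral_mono_of_nonneg (ae_of_all _ fun x => abs_nonneg _)
        ((integrable_indicator_iff Metric.isClosed_closedBall.measurableSet).2
          (integrableOn_const (measure_closedBall_lt_top (x := (0 : E))).ne))
        (ae_of_all _ fun x => ?_)
      by_cases hx : x ∈ B
      · simpa [Set.indicator_of_mem hx] using hC x z
      · have hx1 : R + 1 < ‖x‖ := by simpa [B] using hx
        have e1 : ‖x‖ ≤ ‖x + z‖ + ‖z‖ := norm_le_add_norm_add x z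
        have e2 : ‖x‖ ≤ ‖x - z‖ + ‖z‖ := norm_le_norm_sub_add x z
        simp [Set.indicator_of_notMem hx, hz0 x (by linarith), hz0 (x + z) (by linarith),
          hz0 (x - z) (by linarith)]
    rw [integral_indicator_const _ Metric.isClosed_closedBall.measurableSet, smul_eq_mul] at h1
    have := le_max_left (C * V) (4 * L)
    have h2 : C * V * ‖z‖ ^ 2 ≤ max (C * V) (4 * L) * ‖z‖ ^ 2 := by gcongr
    linarith
  · rw [min_eq_left (one_le_pow₀ hz.le), mul_one]
    refine le_trans ?_ (le_max_right _ _)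
    have i1 := (hi.comp_add_right z).abs
    have i2 := (hi.comp_sub_right z).abs
    have i3 := hi.abs.const_mul 2
    have i12 : Integrable fun x => |θ (x + z)| + |θ (x - z)| := i1.add i2
    have h1 : ∫ x, |θ (x + z) + θ (x - z) - 2 * θ x|
        ≤ ∫ x, (|θ (x + z)| + |θ (x - z)| + 2 * |θ x|) := by
      refine integral_mono_of_nonneg (ae_of_all _ fun x => abs_nonneg _) (i12.add i3)
        (ae_of_all _ fun x => ?_)
      have e1 := abs_sub (θ (x + z) + θ (x - z)) (2 * θ x)
      have e2 := abs_add_le (θ (x + z)) (θ (x - z))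
      rw [abs_mul, abs_two] at e1
      simp only
      linarith
    rw [integral_add i12 i3, integral_add i1 i2, integral_const_mul,
      integral_add_right_eq_self (fun x => |θ x|), integral_sub_right_eq_self (fun x => |θ x|)] at h1
    linarith

lemma integrable_second_difference_div (hN : 0 < N) {α : ℝ} (hα1 : 0 < α) (hα2 : α < 2) {θ : E → ℝ}
    (hθ : ContDiff ℝ (⊤ : ℕ∞) θ) (hc : HasCompactSupport θ) :
    Integrable (fun p : E × E => (θ (p.1 + p.2) + θ (p.1 - p.2) - 2 * θ p.1)
      / ‖p.2‖ ^ ((N : ℝ) + α)) (volume.prod volume) := by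
  have hi : Integrable θ := hθ.continuous.integrable_of_hasCompactSupport hc
  obtain ⟨C, hC⟩ := integral_abs_second_difference_le hθ hc
  have hm : Measurable θ := hθ.continuous.measurable
  have hGm : Measurable fun p : E × E => (θ (p.1 + p.2) + θ (p.1 - p.2) - 2 * θ p.1)
      / ‖p.2‖ ^ ((N : ℝ) + α) := by fun_prop
  rw [integrable_prod_iff' hGm.aestronglyMeasurable]
  refine ⟨ae_of_all _ fun z => (integrable_second_difference hi z).div_const (‖z‖ ^ ((N : ℝ) + α)), ?_⟩
  refine Integrable.mono' ((integrable_min_one_norm_sq_div hN hα1 hα2).const_mul C)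
    hGm.norm.stronglyMeasurable.integral_prod_left'.aestronglyMeasurable (ae_of_all _ fun z => ?_)
  have hz : 0 ≤ ‖z‖ ^ ((N : ℝ) + α) := by positivity
  rw [norm_of_nonneg (integral_nonneg fun x => norm_nonneg _)]
  simp only [norm_div, norm_of_nonneg hz, Real.norm_eq_abs]
  rw [integral_div, ← mul_div_assoc]
  gcongr
  exact hC z

lemma integrable_fracLap (hN : 0 < N) {α : ℝ} (hα1 : 0 < α) (hα2 : α < 2) {θ : E → ℝ}
    (hθ : ContDiff ℝ (⊤ : ℕ∞) θ) (hc : HasCompactSupport θ) : Integrable (fracLap N α θ) :=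
  (integrable_second_difference_div hN hα1 hα2 hθ hc).integral_prod_left.const_mul _

lemma integral_fracLap (hN : 0 < N) {α : ℝ} (hα1 : 0 < α) (hα2 : α < 2) {θ : E → ℝ}
    (hθ : ContDiff ℝ (⊤ : ℕ∞) θ) (hc : HasCompactSupport θ) : ∫ x, fracLap N α θ x = 0 := by
  have hi : Integrable θ := hθ.continuous.integrable_of_hasCompactSupport hc
  unfold fracLap
  rw [integral_const_mul, integral_integral_swap
    (f := fun x z : E => (θ (x + z) + θ (x - z) - 2 * θ x) / ‖z‖ ^ ((N : ℝ) + α))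
    (integrable_second_difference_div hN hα1 hα2 hθ hc)]
  simp only [integral_div, integral_second_difference hi]
  simp

end TestFunction

lemma exists_smooth_hinge : ∃ ψ g : ℝ → ℝ, ContDiff ℝ (⊤ : ℕ∞) ψ ∧ (∀ t, 0 ≤ g t ∧ g t ≤ 1) ∧
    (∀ a b, ψ b + g b * (a - b) ≤ ψ a) ∧ (∀ t ≤ 1, ψ t = 0) ∧ (∀ t, 0 ≤ ψ t) ∧
    ∀ t, t - 2 ≤ ψ t := by
  set g : ℝ → ℝ := fun t => smoothTransition (t - 1) with hg
  have hgs : ContDiff ℝ (⊤ : ℕ∞) g :=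
    smoothTransition.contDiff.comp (contDiff_id.sub contDiff_const)
  have hgm : Monotone g := fun a b h => smoothTransition.monotone (by linarith)
  set ψ : ℝ → ℝ := fun t => ∫ τ in (0 : ℝ)..t, g τ with hψ
  have hd : ∀ t, HasDerivAt ψ (g t) t := fun t =>
    intervalIntegral.integral_hasDerivAt_right (hgs.continuous.intervalIntegrable _ _)
      (hgs.continuous.stronglyMeasurableAtFilter _ _) hgs.continuous.continuousAt
  have hdiff : Differentiable ℝ ψ := fun t => (hd t).differentiableAt
  have hderiv : deriv ψ = g := funext fun t => (hd t).deriv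
  have htan : ∀ a b, ψ b + g b * (a - b) ≤ ψ a := fun a b => by
    rcases le_total b a with h | h
    · have := (convex_Ici b).mul_sub_le_image_sub_of_le_deriv hdiff.continuous.continuousOn
        hdiff.differentiableOn (C := g b) (fun x hx => by
          rw [hderiv]; exact hgm (interior_subset (s := Set.Ici b) hx)) b Set.self_mem_Ici a h h
      linarith
    · have := (convex_Iic b).image_sub_le_mul_sub_of_deriv_le hdiff.continuous.continuousOn
        hdiff.differentiableOn (C := g b) (fun x hx => by
          rw [hderiv]; exact hgm (interior_subset (s := Set.Iic b) hx)) a h b Set.self_mem_Iic h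
      linarith
  have hψ0 : ψ 0 = 0 := intervalIntegral.integral_same
  have hg1 : ∀ t ≤ 1, g t = 0 := fun t ht => smoothTransition.zero_of_nonpos (by linarith)
  have hnn : ∀ t, 0 ≤ ψ t := fun t => by
    have := htan t 0
    rw [hψ0, hg1 0 zero_le_one] at this
    linarith
  refine ⟨ψ, g, contDiff_infty_iff_deriv.2 ⟨hdiff, hderiv ▸ hgs⟩,
    fun t => ⟨smoothTransition.nonneg _, smoothTransition.le_one _⟩, htan, fun t ht => ?_, hnn,
    fun t => ?_⟩
  · have := htan 0 t
    rw [hψ0, hg1 t ht] at this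
    linarith [hnn t]
  · have := htan t 2
    have h2 : g 2 = 1 := smoothTransition.one_of_one_le (by norm_num)
    rw [h2] at this
    linarith [hnn 2]

section RieszBound

variable {N : ℕ}

local notation "E" => EuclideanSpace ℝ (Fin N)

lemma exists_truncated_mollifiedRiesz (hN : 3 ≤ N) {α ε δ : ℝ} (hα1 : 0 < α) (hα2 : α < 2)
    (hε : 0 < ε) (hδ : 0 < δ) (x : E) :
    ∃ θ : E → ℝ, ContDiff ℝ (⊤ : ℕ∞) θ ∧ HasCompactSupport θ ∧ (∀ y, 0 ≤ θ y) ∧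
      (∀ y, mollifiedRiesz N α ε (y - x) - 2 * δ ≤ θ y) ∧
      ∀ᵐ y, -fracLap N α θ y ≤ heatKernel N ε (y - x) := by
  have hN0 : 0 < N := by omega
  obtain ⟨ψ, g, hψ, hg, htan, hψ1, hψnn, hψ2⟩ := exists_smooth_hinge
  set Θ := mollifiedRiesz N α ε with hΘ
  have hΘs : ContDiff ℝ (⊤ : ℕ∞) Θ := contDiff_mollifiedRiesz hN hα2 hε
  set η : E → ℝ := fun w => δ * ψ (Θ w / δ) with hη
  have hηs : ContDiff ℝ (⊤ : ℕ∞) η := contDiff_const.mul (hψ.comp (hΘs.div_const δ))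
  have hηc : HasCompactSupport η := by
    have h1 : ∀ᶠ w in cocompact E, Θ w < δ :=
      (tendsto_mollifiedRiesz_cocompact hN hα2 hε).eventually (gt_mem_nhds hδ)
    obtain ⟨K, hK, hKs⟩ := Filter.mem_cocompact.1 h1
    refine HasCompactSupport.intro hK fun w hw => ?_
    have h2 : Θ w < δ := hKs hw
    simp only [hη]
    rw [hψ1 _ ((div_le_one hδ).2 h2.le), mul_zero]
  have hθs : ContDiff ℝ (⊤ : ℕ∞) fun y => η (y - x) := hηs.comp (contDiff_id.sub contDiff_const)
  have hθc : HasCompactSupport fun y => η (y - x) := hηc.comp_homeomorph (Homeomorph.subRight x)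
  refine ⟨fun y => η (y - x), hθs, hθc, fun y => mul_nonneg hδ.le (hψnn _), fun y => ?_, ?_⟩
  · have h1 := mul_le_mul_of_nonneg_left (hψ2 (Θ (y - x) / δ)) hδ.le
    rw [mul_sub, mul_div_cancel₀ _ hδ.ne'] at h1
    simp only [hη]; linarith
  · filter_upwards [(integrable_second_difference_div hN0 hα1 hα2 hθs hθc).prod_right_ae] with y hy
    obtain ⟨hi, hL⟩ := fracLap_mollifiedRiesz hN hα1 hα2 hε (y - x)
    set m := g (Θ (y - x) / δ)
    obtain ⟨hm0, hm1⟩ := hg (Θ (y - x) / δ)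
    have hmono := integral_mono (hi.const_mul m) hy fun z => by
      have key : ∀ w, δ * ψ (Θ (y - x) / δ) + m * (Θ w - Θ (y - x)) ≤ η w := fun w => by
        have h1 := mul_le_mul_of_nonneg_left (htan (Θ w / δ) (Θ (y - x) / δ)) hδ.le
        have h2 : δ * (ψ (Θ (y - x) / δ) + m * (Θ w / δ - Θ (y - x) / δ))
            = δ * ψ (Θ (y - x) / δ) + m * (Θ w - Θ (y - x)) := by field_simp
        exact h2 ▸ h1
      have k1 := key (y - x + z)
      have k2 := key (y - x - z)
      have k3 : η (y - x) = δ * ψ (Θ (y - x) / δ) := rfl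
      simp only
      rw [← mul_div_assoc, show y + z - x = y - x + z by abel, show y - z - x = y - x - z by abel]
      gcongr
      rw [k3]
      linarith
    rw [integral_const_mul] at hmono
    have hc : 0 ≤ fracLapCoeff N α / 2 := (half_pos (fracLapCoeff_pos N hα1 hα2)).le
    have h1 : m * fracLap N α Θ (y - x) ≤ fracLap N α (fun y => η (y - x)) y := by
      have := mul_le_mul_of_nonneg_left hmono hc
      unfold fracLap
      linarith
    rw [hL] at h1
    have hp := heatKernel_nonneg hε.le (y - x)
    nlinarith

lemma lintegral_mul_riesz_le (hN : 3 ≤ N) {α : ℝ} (hα1 : 0 < α) (hα2 : α < 2)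
    {f u : E → ℝ} (hf : LocallyIntegrable f) (hf0 : ∀ y, 0 ≤ f y) (hu : Continuous u)
    (hu0 : ∀ y, 0 ≤ u y) {M : ℝ} (huM : ∀ y, u y ≤ M)
    (heq : ∀ θ : E → ℝ, ContDiff ℝ (⊤ : ℕ∞) θ → HasCompactSupport θ →
      (∫ y, u y * fracLap N α θ y) = ∫ y, f y * θ y) (x : E) :
    ∫⁻ y, ENNReal.ofReal (f y * (rieszCoeff N α * ‖x - y‖ ^ (-((N : ℝ) - α)))) ≤
      ENNReal.ofReal M := by
  have hN0 : 0 < N := by omega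
  have : Nonempty (Fin N) := ⟨⟨0, hN0⟩⟩
  set ε : ℕ → ℝ := fun n => 1 / ((n : ℝ) + 1) with hεdef
  have hε : ∀ n, 0 < ε n := fun n => by positivity
  have hε0 : Tendsto ε atTop (𝓝 0) := tendsto_one_div_add_atTop_nhds_zero_nat
  choose θ hθs hθc hθ0 hθl hθL using fun n =>
    exists_truncated_mollifiedRiesz hN hα1 hα2 (hε n) (hε n) x
  have hfi : ∀ n, Integrable fun y => f y * θ n y := fun n =>
    hf.integrable_smul_right_of_hasCompactSupport (hθs n).continuous (hθc n)
  have hbound : ∀ n, ∫ y, f y * θ n y ≤ M := fun n => by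
    have hLi := integrable_fracLap hN0 hα1 hα2 (hθs n) (hθc n)
    have hui : Integrable fun y => u y * fracLap N α (θ n) y :=
      hLi.bdd_mul (c := M) hu.aestronglyMeasurable
        (ae_of_all _ fun y => by rw [norm_of_nonneg (hu0 y)]; exact huM y)
    have hpi := (integrable_heatKernel (N := N) (hε n)).comp_sub_right x
    have h1 : ∫ y, (u y * fracLap N α (θ n) y - M * fracLap N α (θ n) y)
        ≤ ∫ y, M * heatKernel N (ε n) (y - x) := by
      refine integral_mono_ae (hui.sub (hLi.const_mul M)) (hpi.const_mul M) ?_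
      filter_upwards [hθL n] with y hy
      have e1 := heatKernel_nonneg (hε n).le (y - x)
      have e2 := mul_le_mul_of_nonneg_left hy (sub_nonneg.2 (huM y))
      have e3 := mul_nonneg (hu0 y) e1
      linarith
    rw [integral_sub hui (hLi.const_mul M), integral_const_mul, integral_const_mul,
      integral_fracLap hN0 hα1 hα2 (hθs n) (hθc n), integral_sub_right_eq_self (heatKernel N (ε n)),
      integral_heatKernel (hε n), heq _ (hθs n) (hθc n)] at h1
    linarith
  refine le_trans (lintegral_mono_ae ?_) (le_trans (lintegral_liminf_le'
    (f := fun n y => ENNReal.ofReal (f y * θ n y)) (u := atTop)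
    fun n => (hfi n).aestronglyMeasurable.aemeasurable.ennreal_ofReal) ?_)
  · filter_upwards [Measure.ae_ne volume x] with y hy
    have hyx : y - x ≠ 0 := sub_ne_zero.2 hy
    have hlim := ofReal_riesz_le_liminf hN hα1 hα2 hε hε0 hyx
    have htz : Tendsto (fun n => ENNReal.ofReal (2 * ε n)) atTop (𝓝 0) := by
      have := (ENNReal.continuous_ofReal.tendsto _).comp (hε0.const_mul 2)
      simpa [Function.comp_def] using this
    have hle : liminf (fun n => ENNReal.ofReal (mollifiedRiesz N α (ε n) (y - x))) atTop
        ≤ liminf (fun n => ENNReal.ofReal (θ n y)) atTop := by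
      rw [← ENNReal.liminf_add_of_right_tendsto_zero htz (fun n => ENNReal.ofReal (θ n y))]
      refine liminf_le_liminf (Eventually.of_forall fun n => ?_)
      simp only [Pi.add_apply]
      rw [← ENNReal.ofReal_add (hθ0 n y) (by have := hε n; positivity)]
      exact ENNReal.ofReal_le_ofReal (by linarith [hθl n y])
    simp_rw [ENNReal.ofReal_mul (hf0 y)]
    rw [ENNReal.liminf_const_mul_of_ne_top ENNReal.ofReal_ne_top, norm_sub_rev]
    gcongr
    exact hlim.trans hle
  · refine liminf_le_of_le (by isBoundedDefault) fun b hb => ?_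
    obtain ⟨n, hn⟩ := hb.exists
    refine hn.trans ?_
    rw [← ofReal_integral_eq_lintegral_ofReal (hfi n)
      (ae_of_all _ fun y => mul_nonneg (hf0 y) (hθ0 n y))]
    exact ENNReal.ofReal_le_ofReal (hbound n)

lemma rieszCoeff_pos {α : ℝ} (hα1 : 0 < α) (hαN : α < N) : 0 < rieszCoeff N α := by
  have h1 := Gamma_pos_of_pos (half_pos hα1)
  have h2 := Gamma_pos_of_pos (half_pos (sub_pos.2 hαN))
  unfold rieszCoeff
  positivity

end RieszBound

/-- necessity part of the transient-set characterization.  For a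
nontrivial nonnegative entire bounded solution `u` with `M = sup u` and
`A = {2u ≤ M}`, the function `s = 2(M-u)` witnesses `α`-transience of `A` and the
Riesz potential of `ρ` over `Aᶜ` is finite, bounded by `M/(C_{N,α} φ(M/2))`. -/
theorem stmt11 (N : ℕ) (hN : 3 ≤ N) (α : ℝ) (hα1 : 0 < α) (hα2 : α < 2)
    (ρ : EuclideanSpace ℝ (Fin N) → ℝ) (hρm : Measurable ρ) (hρnn : ∀ x, 0 ≤ ρ x)
    (hρlb : ∀ R : ℝ, ∃ M : ℝ, ∀ x : EuclideanSpace ℝ (Fin N), ‖x‖ ≤ R → ρ x ≤ M)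
    (φ : ℝ → ℝ) (hφc : ContinuousOn φ (Set.Ici 0)) (hφm : MonotoneOn φ (Set.Ici 0))
    (hφ0 : φ 0 = 0) (hφnn : ∀ t : ℝ, 0 ≤ t → 0 ≤ φ t)
    (hφpos : ∀ t : ℝ, 0 < t → 0 < φ t)
    (u : EuclideanSpace ℝ (Fin N) → ℝ) (hu : IsEntireSol N α ρ φ u)
    (hunt : ∃ x, u x ≠ 0)
    (M : ℝ) (hM : M = ⨆ z : EuclideanSpace ℝ (Fin N), u z)
    (A : Set (EuclideanSpace ℝ (Fin N))) (hA : A = {x | 2 * u x ≤ M})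
    (s : EuclideanSpace ℝ (Fin N) → ℝ) (hs : s = fun x => 2 * (M - u x)) :
    (0 < M ∧ Continuous s ∧ (∀ x, 0 ≤ s x) ∧
      (∀ θ : EuclideanSpace ℝ (Fin N) → ℝ, ContDiff ℝ (⊤ : ℕ∞) θ → HasCompactSupport θ →
        (∀ x, 0 ≤ θ x) → (∫ x, s x * fracLap N α θ x) ≤ 0) ∧
      (∀ x ∈ A, M ≤ s x) ∧ (∃ x₁, s x₁ < M)) ∧
    (∀ x : EuclideanSpace ℝ (Fin N),
      IntegrableOn (fun y => ρ y * ‖x - y‖ ^ (-((N : ℝ) - α))) Aᶜ ∧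
      (∫ y in Aᶜ, ρ y * ‖x - y‖ ^ (-((N : ℝ) - α))) ≤
        M / (rieszCoeff N α * φ (M / 2))) := by
  obtain ⟨huc, ⟨B, hB⟩, hu0, hfl, heq⟩ := hu
  have hN0 : 0 < N := by omega
  have hbdd : BddAbove (Set.range u) := ⟨B, by rintro _ ⟨y, rfl⟩; exact hB y⟩
  have huM : ∀ y, u y ≤ M := fun y => hM ▸ le_ciSup hbdd y
  have hMpos : 0 < M := by
    obtain ⟨y, hy⟩ := hunt
    exact ((hu0 y).lt_of_ne' hy).trans_le (huM y)
  have hf0 : ∀ y, 0 ≤ ρ y * φ (u y) := fun y => mul_nonneg (hρnn y) (hφnn _ (hu0 y))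
  refine ⟨⟨hMpos, ?_, ?_, ?_, ?_, ?_⟩, fun x => ?_⟩
  · rw [hs]; fun_prop
  · intro y
    have := huM y
    simp only [hs]; linarith
  · intro θ hθs hθc hθ0
    have hLi := integrable_fracLap hN0 hα1 hα2 hθs hθc
    have hui : Integrable fun y => u y * fracLap N α θ y :=
      hLi.bdd_mul (c := M) huc.aestronglyMeasurable
        (ae_of_all _ fun y => by rw [norm_of_nonneg (hu0 y)]; exact huM y)
    have h1 : ∀ y, s y * fracLap N α θ y
        = 2 * (M * fracLap N α θ y - u y * fracLap N α θ y) := fun y => by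
      simp only [hs]; ring
    simp only [h1]
    rw [integral_const_mul, integral_sub (hLi.const_mul M) hui, integral_const_mul,
      integral_fracLap hN0 hα1 hα2 hθs hθc, heq θ hθs hθc]
    have : 0 ≤ ∫ y, ρ y * φ (u y) * θ y := integral_nonneg fun y => mul_nonneg (hf0 y) (hθ0 y)
    linarith
  · intro y hy
    rw [hA] at hy
    have hy2 : 2 * u y ≤ M := hy
    simp only [hs]; linarith
  · obtain ⟨y, hy⟩ := exists_lt_of_lt_ciSup (show M / 2 < ⨆ z, u z from hM ▸ half_lt_self hMpos)
    exact ⟨y, by simp only [hs]; linarith⟩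
  · have hφM := hφpos _ (half_pos hMpos)
    have hC : 0 < rieszCoeff N α :=
      rieszCoeff_pos hα1 (by have : (3 : ℝ) ≤ N := by exact_mod_cast hN
                             linarith)
    set c := rieszCoeff N α * φ (M / 2) with hc
    have hcpos : 0 < c := mul_pos hC hφM
    have hAm : MeasurableSet Aᶜ := by
      rw [hA]
      exact (isClosed_le (continuous_const.mul huc) continuous_const).measurableSet.compl
    have hk0 : ∀ y, 0 ≤ ρ y * ‖x - y‖ ^ (-((N : ℝ) - α)) := fun y => by
      have := hρnn y
      positivity
    have hkm : Measurable fun y => ρ y * ‖x - y‖ ^ (-((N : ℝ) - α)) := by fun_prop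
    have hlin : ∫⁻ y in Aᶜ, ENNReal.ofReal (ρ y * ‖x - y‖ ^ (-((N : ℝ) - α)))
        ≤ ENNReal.ofReal (M / c) := by
      have h1 : ∀ y ∈ Aᶜ, ENNReal.ofReal (ρ y * ‖x - y‖ ^ (-((N : ℝ) - α)))
          ≤ ENNReal.ofReal c⁻¹ * ENNReal.ofReal
            (ρ y * φ (u y) * (rieszCoeff N α * ‖x - y‖ ^ (-((N : ℝ) - α)))) := fun y hy => by
        rw [← ENNReal.ofReal_mul (by positivity)]
        refine ENNReal.ofReal_le_ofReal ?_
        have hy2 : M / 2 ≤ u y := by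
          rw [hA, Set.mem_compl_iff, Set.mem_ofPred_eq, not_le] at hy
          linarith
        have h2 : φ (M / 2) ≤ φ (u y) := hφm (half_pos hMpos).le (hu0 y) hy2
        rw [le_inv_mul_iff₀ hcpos]
        have h3 := mul_le_mul_of_nonneg_left h2 (mul_nonneg (hk0 y) hC.le)
        rw [hc]
        linarith
      refine (setLIntegral_mono' hAm h1).trans ?_
      rw [lintegral_const_mul' _ _ ENNReal.ofReal_ne_top, div_eq_inv_mul,
        ENNReal.ofReal_mul (by positivity)]
      gcongr
      exact (setLIntegral_le_lintegral _ _).trans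
        (lintegral_mul_riesz_le hN hα1 hα2 hfl hf0 huc hu0 huM heq x)
    constructor
    · refine ⟨hkm.aestronglyMeasurable, ?_⟩
      rw [hasFiniteIntegral_iff_ofReal (ae_of_all _ hk0)]
      exact hlin.trans_lt ENNReal.ofReal_lt_top
    · rw [integral_eq_lintegral_of_nonneg_ae (ae_of_all _ hk0) hkm.aestronglyMeasurable]
      exact ENNReal.toReal_le_of_le_ofReal (by positivity) hlin
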